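/- Fix N ≥ 1 and d ∈ ℕ^{N+1}, and let r and s be admissible rank patterns for d. Let O_r (respectively O_s) denote the set of tuples A_* ∈ Rep_d(ℂ) with rank(A_j ⋯ A_{i+1}) = r_{ij} (respectively = s_{ij}) for all 0 ≤ i < j ≤ N. Then O_s is contained in the closure of O_r in the Euclidean topology of Rep_d(ℂ) if and only if s_{ij} ≤ r_{ij} for all 0 ≤ i < j ≤ N. -/

import Mathlib

/-- The product `A_j ⋯ A_{i+2} A_{i+1}` (a segment of length `n` starting at vertex `i`)
of a tuple of composable matrices. -/
def matProdSeg (k : Type) [Field k] (d : ℕ → ℕ)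
    (A : ∀ i : ℕ, Matrix (Fin (d (i + 1))) (Fin (d i)) k) (i : ℕ) :
    ∀ n : ℕ, Matrix (Fin (d (i + n))) (Fin (d i)) k
  | 0 => (1 : Matrix (Fin (d i)) (Fin (d i)) k)
  | n + 1 => A (i + n) * matProdSeg k d A i n

/-- The extension of a rank pattern `r` to all integer indices, by `0`
outside the triangle `0 ≤ i ≤ j ≤ N`. -/
def rkExt (N : ℕ) (r : ℕ → ℕ → ℕ) : ℤ → ℤ → ℤ := fun i j =>
  if 0 ≤ i ∧ i ≤ j ∧ j ≤ (N : ℤ) then (r i.toNat j.toNat : ℤ) else 0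

/-- A rank pattern is admissible if all its second differences are nonnegative. -/
def RankAdmissible (N : ℕ) (r : ℕ → ℕ → ℕ) : Prop :=
  ∀ i j : ℤ, 0 ≤ i → i ≤ j → j ≤ (N : ℤ) →
    0 ≤ rkExt N r i j - rkExt N r i (j + 1) - rkExt N r (i - 1) j +
      rkExt N r (i - 1) (j + 1)

/-- The locus of tuples of composable complex matrices realizing the rank pattern `r`. -/
def rankLocus (N : ℕ) (d : ℕ → ℕ) (r : ℕ → ℕ → ℕ) :
    Set (∀ i : Fin N, Matrix (Fin (d ((i : ℕ) + 1))) (Fin (d (i : ℕ))) ℂ) :=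
  {x | ∀ i j : ℕ, i < j → j ≤ N →
    (matProdSeg ℂ d (fun i => if h : i < N then x ⟨i, h⟩ else 0) i (j - i)).rank = r i j}

open Module

section Linear
variable {K : Type*} [Field K]

theorem finrank_map_add_finrank_inf_ker {Y Z : Type*} [AddCommGroup Y] [Module K Y]
    [AddCommGroup Z] [Module K Z] [FiniteDimensional K Y] (g : Y →ₗ[K] Z) (S : Submodule K Y) :
    finrank K (S.map g) + finrank K (S ⊓ LinearMap.ker g : Submodule K Y) = finrank K S := by
  have h := LinearMap.finrank_range_add_finrank_ker (g.domRestrict S)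
  rw [LinearMap.range_domRestrict, LinearMap.ker_domRestrict] at h
  rw [← h, ← Submodule.map_comap_subtype, Submodule.finrank_map_subtype_eq]

theorem exists_apply_notMem_of_finrank_lt {X Y Z : Type*} [AddCommGroup X] [Module K X]
    [AddCommGroup Y] [Module K Y] [AddCommGroup Z] [Module K Z] [FiniteDimensional K Y]
    (f : X →ₗ[K] Y) (g : Y →ₗ[K] Z) (W : Submodule K Y)
    (h : finrank K W + finrank K (LinearMap.range (g ∘ₗ f)) <
      finrank K (LinearMap.range f) + finrank K (W.map g)) :
    ∃ v, g (f v) = 0 ∧ f v ∉ W := by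
  by_contra! hc
  have hle : LinearMap.range f ⊓ LinearMap.ker g ≤ W ⊓ LinearMap.ker g := by
    rintro _ ⟨⟨v, rfl⟩, hv⟩
    exact ⟨hc v hv, hv⟩
  have h1 := finrank_map_add_finrank_inf_ker g W
  have h2 := finrank_map_add_finrank_inf_ker g (LinearMap.range f)
  have h3 := Submodule.finrank_mono hle
  rw [← LinearMap.range_comp] at h2
  omega

theorem range_add_smulRight_of_mem {X Y : Type*} [AddCommGroup X] [Module K X]
    [AddCommGroup Y] [Module K Y] (f : X →ₗ[K] Y) (ψ : X →ₗ[K] K) (z : X) (t : K)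
    (h : 1 + t * ψ z ≠ 0) :
    LinearMap.range (f + t • ψ.smulRight (f z)) = LinearMap.range f := by
  apply le_antisymm
  · rintro _ ⟨x, rfl⟩
    exact ⟨x + (t * ψ x) • z, by simp [mul_smul]⟩
  · have hz : f z ∈ LinearMap.range (f + t • ψ.smulRight (f z)) := by
      refine ⟨(1 + t * ψ z)⁻¹ • z, ?_⟩
      have : (f + t • ψ.smulRight (f z)) z = (1 + t * ψ z) • f z := by
        simp [add_smul, mul_smul]
      rw [map_smul, this, inv_smul_smul₀ h]
    rintro _ ⟨x, rfl⟩
    have hx := Submodule.sub_mem _ (LinearMap.mem_range_self (f + t • ψ.smulRight (f z)) x)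
      (Submodule.smul_mem _ (t * ψ x) hz)
    simpa [mul_smul] using hx

theorem finrank_range_add_smulRight {X Y : Type*} [AddCommGroup X] [Module K X]
    [AddCommGroup Y] [Module K Y] [FiniteDimensional K Y] (f : X →ₗ[K] Y) (ψ : X →ₗ[K] K) (y : Y)
    (w : X) {t : K} (ht : t ≠ 0) (hy : y ∉ LinearMap.range f) (hw : f w = 0) (hψ : ψ w ≠ 0) :
    finrank K (LinearMap.range (f + t • ψ.smulRight y)) = finrank K (LinearMap.range f) + 1 := by
  have hmem : y ∈ LinearMap.range (f + t • ψ.smulRight y) :=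
    ⟨(t * ψ w)⁻¹ • w, by simp [hw, smul_smul]; field_simp; simp⟩
  have hrange : LinearMap.range (f + t • ψ.smulRight y) = LinearMap.range f ⊔ K ∙ y := by
    apply le_antisymm
    · rintro _ ⟨x, rfl⟩
      refine Submodule.add_mem_sup ⟨x, rfl⟩ ?_
      exact Submodule.smul_mem _ _ (Submodule.smul_mem _ _ (Submodule.mem_span_singleton_self y))
    · refine sup_le ?_ ((Submodule.span_singleton_le_iff_mem _ _).2 hmem)
      rintro _ ⟨x, rfl⟩
      have hx := Submodule.sub_mem _ (LinearMap.mem_range_self (f + t • ψ.smulRight y) x)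
        (Submodule.smul_mem _ (t * ψ x) hmem)
      simpa [mul_smul] using hx
  rw [hrange]
  exact Submodule.finrank_sup_span_singleton hy

end Linear

section Segments
variable {K : Type*} [Field K] {V : ℕ → Type*} [∀ i, AddCommGroup (V i)] [∀ i, Module K (V i)]

/-- The composite `A_{j-1} ∘ ⋯ ∘ A_i : V_i → V_j` of a sequence of composable linear maps. -/
def segMap (A : ∀ i, V i →ₗ[K] V (i + 1)) (i : ℕ) {j : ℕ} (h : i ≤ j) : V i →ₗ[K] V j :=
  Nat.leRec (motive := fun j _ => V i →ₗ[K] V j) LinearMap.id (fun j _ f => A j ∘ₗ f) h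

variable (A : ∀ i, V i →ₗ[K] V (i + 1))

theorem segMap_self (i : ℕ) : segMap A i le_rfl = LinearMap.id :=
  Nat.leRec_self _ _

theorem segMap_succ {i j : ℕ} (h : i ≤ j) (h' : i ≤ j + 1) :
    segMap A i h' = A j ∘ₗ segMap A i h :=
  Nat.leRec_succ _ _ _

theorem segMap_comp {i j k : ℕ} (hij : i ≤ j) (hjk : j ≤ k) :
    segMap A i (hij.trans hjk) = segMap A j hjk ∘ₗ segMap A i hij := by
  induction k, hjk using Nat.le_induction with
  | base => rw [segMap_self, LinearMap.id_comp]
  | succ k hjk ih =>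
    rw [segMap_succ A (hij.trans hjk), segMap_succ A hjk, ih, LinearMap.comp_assoc]

theorem segMap_segMap {i j k : ℕ} (hij : i ≤ j) (hjk : j ≤ k) (hik : i ≤ k) (x : V i) :
    segMap A j hjk (segMap A i hij x) = segMap A i hik x := by
  rw [segMap_comp A hij hjk, LinearMap.comp_apply]

theorem segMap_congr {A A' : ∀ i, V i →ₗ[K] V (i + 1)} {i j : ℕ} (h : i ≤ j)
    (hA : ∀ n, i ≤ n → n < j → A' n = A n) : segMap A' i h = segMap A i h := by
  induction j, h using Nat.le_induction with
  | base => rw [segMap_self, segMap_self]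
  | succ k hik ih =>
    rw [segMap_succ A' hik, segMap_succ A hik, hA k hik k.lt_succ_self,
      ih fun n h1 h2 => hA n h1 (h2.trans k.lt_succ_self)]

theorem segMap_add_smulRight {A A' : ∀ i, V i →ₗ[K] V (i + 1)} {j : ℕ} {φ : V j →ₗ[K] K}
    {u : V (j + 1)} {t : K} (hne : ∀ n, n ≠ j → A' n = A n)
    (hj : A' j = A j + t • φ.smulRight u) {a b : ℕ} (haj : a ≤ j) (hjb : j + 1 ≤ b) (hab : a ≤ b) :
    segMap A' a hab =
      segMap A a hab + t • (φ ∘ₗ segMap A a haj).smulRight (segMap A (j + 1) hjb u) := by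
  have h1 : segMap A' a haj = segMap A a haj := segMap_congr _ fun n _ h => hne n h.ne
  have h2 : segMap A' (j + 1) hjb = segMap A (j + 1) hjb :=
    segMap_congr _ fun n h _ => hne n (Nat.lt_of_succ_le h).ne'
  have h3 : a ≤ j + 1 := haj.trans j.le_succ
  rw [segMap_comp A' h3 hjb, segMap_comp A h3 hjb, segMap_succ A' haj, segMap_succ A haj, h1, h2, hj]
  ext x
  simp

/-- Adding a small rank one map at the arrow `j`, supported on two strings of vectors which
generate direct summands for the intervals `[i, j]` and `[k, l]`, raises by one the ranks of
exactly the composites from `a ∈ [i, k)` to `b ∈ (j, l]`. -/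
theorem finrank_range_segMap_add_smulRight [∀ i, FiniteDimensional K (V i)]
    {A A' : ∀ i, V i →ₗ[K] V (i + 1)} {i j k l : ℕ}
    (hij : i ≤ j) (hkl : k ≤ l) (hkj : k ≤ j + 1) {v : V k} {w : V i} {φ : V j →ₗ[K] K} {t : K}
    (hv : segMap A k (hkl.trans l.le_succ) v = 0)
    (hv' : ∀ a (h : a < k), segMap A k hkl v ∉ LinearMap.range (segMap A a (h.le.trans hkl)))
    (hw : segMap A i (hij.trans j.le_succ) w = 0) (hw' : φ (segMap A i hij w) ≠ 0)
    (hφ : ∀ a (h : a < i), φ ∘ₗ segMap A a (h.le.trans hij) = 0)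
    (ht : t ≠ 0) (ht' : ∀ h : k ≤ j, 1 + t * φ (segMap A k h v) ≠ 0)
    (hne : ∀ n, n ≠ j → A' n = A n)
    (hj : A' j = A j + t • φ.smulRight (segMap A k hkj v)) {a b : ℕ} (hab : a ≤ b) :
    Module.finrank K (LinearMap.range (segMap A' a hab)) =
      Module.finrank K (LinearMap.range (segMap A a hab)) +
        if i ≤ a ∧ a < k ∧ j < b ∧ b ≤ l then 1 else 0 := by
  rcases Nat.lt_or_ge j a with hja | haj
  · rw [segMap_congr hab fun n h _ => hne n (hja.trans_le h).ne', if_neg (by omega), add_zero]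
  rcases Nat.lt_or_ge j b with hjb | hbj
  swap
  · rw [segMap_congr hab fun n _ h => hne n (h.trans_le hbj).ne, if_neg (by omega), add_zero]
  rw [segMap_add_smulRight hne hj haj hjb hab]
  have hkb : k ≤ b := hkj.trans hjb
  rw [segMap_segMap A hkj hjb hkb]
  rcases Nat.lt_or_ge a i with hai | hia
  · rw [hφ a hai, if_neg (by omega), LinearMap.zero_smulRight, smul_zero,
      add_zero, add_zero]
  rcases Nat.lt_or_ge l b with hlb | hbl
  · rw [← segMap_segMap A (hkl.trans l.le_succ) hlb hkb, hv, if_neg (by omega), map_zero,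
      LinearMap.smulRight_zero, smul_zero, add_zero, add_zero]
  rcases Nat.lt_or_ge a k with hak | hka
  · rw [if_pos ⟨hia, hak, hjb, hbl⟩]
    refine finrank_range_add_smulRight _ _ _ (segMap A i hia w) ht ?_ ?_ ?_
    · rintro ⟨x, hx⟩
      refine hv' a hak ⟨x, ?_⟩
      rw [← segMap_segMap A hab hbl, hx, segMap_segMap]
    · rw [segMap_segMap A hia hab (hia.trans hab),
        ← segMap_segMap A (hij.trans j.le_succ) hjb, hw, map_zero]
    · rwa [LinearMap.comp_apply, segMap_segMap]
  · rw [← segMap_segMap A hka hab hkb, range_add_smulRight_of_mem, if_neg (by omega), add_zero]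
    rw [LinearMap.comp_apply, segMap_segMap A hka haj (hka.trans haj)]
    exact ht' _

/-- If the space `W` containing the images from vertices before `k` is small enough, then some
vector at `k` generates an interval summand `[k, l]`, and some functional detects it. -/
theorem exists_segMap_generator [∀ i, FiniteDimensional K (V i)] {k l : ℕ} (hkl : k ≤ l)
    (W : Submodule K (V l))
    (hW : ∀ a (h : a < k), LinearMap.range (segMap A a (h.le.trans hkl)) ≤ W)
    (h : finrank K W + finrank K (LinearMap.range (segMap A k (hkl.trans l.le_succ))) <
      finrank K (LinearMap.range (segMap A k hkl)) + finrank K (W.map (A l))) :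
    ∃ (v : V k) (φ : V l →ₗ[K] K), segMap A k (hkl.trans l.le_succ) v = 0 ∧
      φ (segMap A k hkl v) ≠ 0 ∧ ∀ a (h : a < k), φ ∘ₗ segMap A a (h.le.trans hkl) = 0 := by
  rw [segMap_succ A hkl] at h ⊢
  obtain ⟨v, hv, hvW⟩ := exists_apply_notMem_of_finrank_lt _ _ _ h
  obtain ⟨φ, hφv, hφ⟩ := Submodule.exists_le_ker_of_notMem hvW
  exact ⟨v, φ, hv, hφv, fun a ha => LinearMap.range_le_ker_iff.1 ((hW a ha).trans hφ)⟩

end Segments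

section Combinatorics

/-- The second difference of a rank function: the multiplicity of the interval `[i, j]`. -/
def intervalMult (S : ℤ → ℤ → ℤ) (i j : ℤ) : ℤ :=
  S i j - S i (j + 1) - S (i - 1) j + S (i - 1) (j + 1)

theorem Int.le_of_forall_le_succ {f : ℤ → ℤ} {x y : ℤ} (hxy : x ≤ y)
    (hf : ∀ z, x ≤ z → z < y → f z ≤ f (z + 1)) : f x ≤ f y := by
  induction y, hxy using Int.leInduction with
  | base => exact le_rfl
  | succ y hxy ih =>
    exact (ih fun z h1 h2 => hf z h1 (by omega)).trans (hf y hxy (by omega))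

theorem Int.exists_last_lt {f : ℤ → ℤ} {lo hi : ℤ} (hlt : lo ≤ hi) (hf : f lo < f hi) :
    ∃ i, lo < i ∧ i ≤ hi ∧ f (i - 1) < f hi ∧ ∀ x, i ≤ x → x ≤ hi → f hi ≤ f x := by
  obtain ⟨m, ⟨hm, hmf⟩, hmax⟩ := Int.exists_greatest_of_bdd
    (P := fun z => z ≤ hi ∧ f z < f hi) ⟨hi, fun z hz => hz.1⟩ ⟨lo, hlt, hf⟩
  have hne : m ≠ hi := by rintro rfl; exact lt_irrefl _ hmf
  refine ⟨m + 1, ?_, by omega, by simpa using hmf, fun x h1 h2 => ?_⟩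
  · have := hmax lo ⟨hlt, hf⟩
    omega
  · by_contra! h
    have := hmax x ⟨h2, h⟩
    omega

/-- If the rank function `S` lies below `R` without being equal to it, there are two intervals
`[i, j]` and `[k, l]` occurring in `S` such that exchanging their endpoints
gives a rank function which is still below `R`. -/
theorem exists_exchange {N : ℤ} {R S : ℤ → ℤ → ℤ}
    (hR : ∀ i j, 0 ≤ i → i ≤ j → j ≤ N → 0 ≤ intervalMult R i j)
    (hR0 : ∀ i j, i < 0 ∨ N < j → R i j = 0) (hS0 : ∀ i j, i < 0 ∨ N < j → S i j = 0)
    (hle : ∀ i j, 0 ≤ i → i ≤ j → j ≤ N → S i j ≤ R i j)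
    (hdiag : ∀ i, 0 ≤ i → i ≤ N → S i i = R i i)
    {a₀ b₀ : ℤ} (ha₀ : 0 ≤ a₀) (hab₀ : a₀ ≤ b₀) (hb₀ : b₀ ≤ N) (hlt : S a₀ b₀ < R a₀ b₀) :
    ∃ i j k l : ℤ, 0 ≤ i ∧ i < k ∧ k ≤ j + 1 ∧ j < l ∧ l ≤ N ∧
      0 < intervalMult S i j ∧ 0 < intervalMult S k l ∧
      ∀ x y, i ≤ x → x < k → j < y → y ≤ l → S x y < R x y := by
  obtain ⟨n, ⟨a, b, ha, hab, hbN, hn, hD⟩, hmin⟩ := Int.exists_least_of_bdd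
    (P := fun n => ∃ a b, 0 ≤ a ∧ a ≤ b ∧ b ≤ N ∧ b - a = n ∧ S a b < R a b)
    ⟨0, by rintro z ⟨a, b, _, _, _, _, _⟩; omega⟩ ⟨_, a₀, b₀, ha₀, hab₀, hb₀, rfl, hlt⟩
  have hab' : a < b := by
    rcases hab.lt_or_eq with h | rfl
    · exact h
    · have := hdiag a ha hbN
      omega
  have hleft : R a (b - 1) = S a (b - 1) := by
    by_contra h
    have := hle a (b - 1) ha (by omega) (by omega)
    have := hmin _ ⟨a, b - 1, ha, by omega, by omega, rfl, by omega⟩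
    omega
  have hbelow : R (a + 1) b = S (a + 1) b := by
    by_contra h
    have := hle (a + 1) b (by omega) (by omega) (by omega)
    have := hmin _ ⟨a + 1, b, by omega, by omega, by omega, rfl, by omega⟩
    omega
  have hcolR : ∀ x y, -1 ≤ x → x ≤ y → y ≤ a → R x (b - 1) - R x b ≤ R y (b - 1) - R y b := by
    intro x y h1 h2 h3
    refine Int.le_of_forall_le_succ (f := fun z => R z (b - 1) - R z b) h2 fun z h4 h5 => ?_
    have := hR (z + 1) (b - 1) (by omega) (by omega) (by omega)
    simp only [intervalMult, sub_add_cancel, add_sub_cancel_right] at this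
    linarith
  obtain ⟨i, hi0, hia, hi, hlast⟩ := Int.exists_last_lt (lo := -1) (hi := a)
    (f := fun x => S x (b - 1) - S x b) (by omega) (by
      have h1 := hcolR (-1) a le_rfl (by omega) le_rfl
      have h2 := hR0 (-1) (b - 1) (by omega)
      have h3 := hR0 (-1) b (by omega)
      have h4 := hS0 (-1) (b - 1) (by omega)
      have h5 := hS0 (-1) b (by omega)
      omega)
  have hmi : 0 < intervalMult S i (b - 1) := by
    have := hlast i le_rfl hia
    simp only [intervalMult, sub_add_cancel]
    omega
  have hexists : ∃ q, ∃ p, b ≤ q ∧ q ≤ N ∧ i < p ∧ p ≤ a + 1 ∧ 0 < intervalMult S p q := by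
    by_contra! hc
    have h1 : S (a + 1) b - S a b ≤ S (a + 1) (N + 1) - S a (N + 1) := by
      refine Int.le_of_forall_le_succ (f := fun z => S (a + 1) z - S a z) (by omega)
        fun z h4 h5 => ?_
      have := hc z (a + 1) h4 (by omega) (by omega) le_rfl
      simp only [intervalMult, add_sub_cancel_right] at this
      linarith
    have h2 : -(R (a + 1) b - R a b) ≤ -(R (a + 1) (N + 1) - R a (N + 1)) := by
      refine Int.le_of_forall_le_succ (f := fun z => -(R (a + 1) z - R a z)) (by omega)
        fun z h4 h5 => ?_
      have := hR (a + 1) z (by omega) (by omega) (by omega)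
      simp only [intervalMult, add_sub_cancel_right] at this
      linarith
    have h3 := hR0 (a + 1) (N + 1) (by omega)
    have h4 := hR0 a (N + 1) (by omega)
    have h5 := hS0 (a + 1) (N + 1) (by omega)
    have h6 := hS0 a (N + 1) (by omega)
    omega
  obtain ⟨q, ⟨p, hbq, hqN, hip, hpa, hpq⟩, hqmin⟩ := Int.exists_least_of_bdd
    (P := fun q => ∃ p, b ≤ q ∧ q ≤ N ∧ i < p ∧ p ≤ a + 1 ∧ 0 < intervalMult S p q)
    ⟨b, by rintro z ⟨_, h, _⟩; exact h⟩ hexists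
  refine ⟨i, b - 1, p, q, by omega, hip, by omega, by omega, hqN, hmi, hpq, ?_⟩
  intro x y hix hxp hby hyq
  have hby' : b ≤ y := by omega
  have hstrip : S x b < R x b := by
    have h1 := hlast x hix (by omega)
    have h2 := hcolR x a (by omega) (by omega) le_rfl
    have h3 := hle x (b - 1) (by omega) (by omega) (by omega)
    omega
  have hrow : ∀ z, i < z → z ≤ a + 1 →
      S z b - S (z - 1) b ≤ S z y - S (z - 1) y ∧ R z y - R (z - 1) y ≤ R z b - R (z - 1) b := by
    intro z hz1 hz2
    constructor
    · refine Int.le_of_forall_le_succ (f := fun c => S z c - S (z - 1) c) hby' fun c h1 h2 => ?_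
      have h3 : ¬ 0 < intervalMult S z c := fun h => by
        have := hqmin c ⟨z, h1, by omega, hz1, hz2, h⟩
        omega
      simp only [intervalMult] at h3
      linarith
    · have := Int.le_of_forall_le_succ (f := fun c => -(R z c - R (z - 1) c)) hby' fun c h1 h2 => by
        have h3 := hR z c (by omega) (by omega) (by omega)
        simp only [intervalMult] at h3
        linarith
      linarith
  have hmono : (R x b - S x b) - (R x y - S x y) ≤
      (R (a + 1) b - S (a + 1) b) - (R (a + 1) y - S (a + 1) y) := by
    refine Int.le_of_forall_le_succ
      (f := fun z => (R z b - S z b) - (R z y - S z y)) (by omega) fun z h1 h2 => ?_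
    have h3 := hrow (z + 1) (by omega) (by omega)
    simp only [add_sub_cancel_right] at h3
    linarith
  have := hle (a + 1) y (by omega) (by omega) (by omega)
  omega

end Combinatorics

section RankLocus
variable {N : ℕ} {d : ℕ → ℕ}

/-- The linear maps of a tuple of composable matrices, continued by zero. -/
noncomputable def tupleMaps (N : ℕ) (d : ℕ → ℕ)
    (x : ∀ i : Fin N, Matrix (Fin (d ((i : ℕ) + 1))) (Fin (d (i : ℕ))) ℂ) (i : ℕ) :
    (Fin (d i) → ℂ) →ₗ[ℂ] (Fin (d (i + 1)) → ℂ) :=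
  (if h : i < N then x ⟨i, h⟩ else 0 : Matrix (Fin (d (i + 1))) (Fin (d i)) ℂ).mulVecLin

theorem mulVecLin_matProdSeg (A : ∀ i : ℕ, Matrix (Fin (d (i + 1))) (Fin (d i)) ℂ) (i n : ℕ) :
    (matProdSeg ℂ d A i n).mulVecLin =
      segMap (V := fun i => Fin (d i) → ℂ) (fun i => (A i).mulVecLin) i (Nat.le_add_right i n) := by
  induction n with
  | zero => exact Matrix.mulVecLin_one.trans (segMap_self (V := fun i => Fin (d i) → ℂ) _ i).symm
  | succ n ih =>
    have := segMap_succ (V := fun i => Fin (d i) → ℂ) (fun i => (A i).mulVecLin)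
      (Nat.le_add_right i n) (Nat.le_add_right i (n + 1))
    exact (Matrix.mulVecLin_mul _ _).trans ((congrArg _ ih).trans this.symm)

theorem mem_rankLocus_iff {r : ℕ → ℕ → ℕ}
    {x : ∀ i : Fin N, Matrix (Fin (d ((i : ℕ) + 1))) (Fin (d (i : ℕ))) ℂ} :
    x ∈ rankLocus N d r ↔ ∀ i j (h : i < j), j ≤ N →
      finrank ℂ (LinearMap.range
        (segMap (V := fun i => Fin (d i) → ℂ) (tupleMaps N d x) i h.le)) = r i j := by
  refine forall_congr' fun i => forall_congr' fun j => forall_congr' fun h =>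
    forall_congr' fun _ => ?_
  obtain ⟨n, rfl⟩ := Nat.exists_eq_add_of_le h.le
  rw [Nat.add_sub_cancel_left, Matrix.rank, mulVecLin_matProdSeg]
  rfl

theorem rkExt_of_le {r : ℕ → ℕ → ℕ} {i j : ℕ} (hij : i ≤ j) (hj : j ≤ N) :
    rkExt N r i j = r i j := by
  simp [rkExt, hij, hj]

theorem rkExt_eq_zero {r : ℕ → ℕ → ℕ} {i j : ℤ} (h : i < 0 ∨ N < j) : rkExt N r i j = 0 :=
  if_neg (by omega)

theorem rkExt_eq_finrank {s : ℕ → ℕ → ℕ} (hdiag : ∀ i ≤ N, s i i = d i)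
    {x : ∀ i : Fin N, Matrix (Fin (d ((i : ℕ) + 1))) (Fin (d (i : ℕ))) ℂ}
    (hx : x ∈ rankLocus N d s) {k l : ℕ} (hkl : k ≤ l) (hk : k ≤ N) (hl : l ≤ N + 1) :
    rkExt N s k l = finrank ℂ (LinearMap.range
      (segMap (V := fun i => Fin (d i) → ℂ) (tupleMaps N d x) k hkl)) := by
  rcases Nat.lt_or_ge N l with h | h
  · obtain rfl : l = N + 1 := by omega
    have h0 : tupleMaps N d x N = 0 := by
      rw [tupleMaps, dif_neg (lt_irrefl N)]
      exact Matrix.mulVecLin_zero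
    rw [rkExt_eq_zero (by omega), segMap_succ _ hk, h0, LinearMap.zero_comp, LinearMap.range_zero,
      finrank_bot, Nat.cast_zero]
  rw [rkExt_of_le hkl h]
  rcases hkl.lt_or_eq with hlt | rfl
  · rw [mem_rankLocus_iff.1 hx k l hlt h]
  · rw [segMap_self, LinearMap.range_id, finrank_top, Module.finrank_fin_fun, hdiag k h]

theorem exists_tuple_generator {s : ℕ → ℕ → ℕ} (hdiag : ∀ i ≤ N, s i i = d i)
    {x : ∀ i : Fin N, Matrix (Fin (d ((i : ℕ) + 1))) (Fin (d (i : ℕ))) ℂ}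
    (hx : x ∈ rankLocus N d s) {k l : ℕ} (hkl : k ≤ l) (hl : l ≤ N)
    (hm : 0 < intervalMult (rkExt N s) k l) :
    ∃ (v : Fin (d k) → ℂ) (φ : (Fin (d l) → ℂ) →ₗ[ℂ] ℂ),
      segMap (V := fun i => Fin (d i) → ℂ) (tupleMaps N d x) k (hkl.trans l.le_succ) v = 0 ∧
      φ (segMap (V := fun i => Fin (d i) → ℂ) (tupleMaps N d x) k hkl v) ≠ 0 ∧
      ∀ a (h : a < k), φ ∘ₗ segMap (V := fun i => Fin (d i) → ℂ) (tupleMaps N d x) a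
        (h.le.trans hkl) = 0 := by
  have h1 := rkExt_eq_finrank hdiag hx hkl (by omega) (by omega)
  have h2 := rkExt_eq_finrank hdiag hx (hkl.trans l.le_succ) (by omega) (by omega)
  rw [intervalMult] at hm
  push_cast at h2
  rw [h1, h2] at hm
  cases k with
  | zero =>
    refine exists_segMap_generator (V := fun i => Fin (d i) → ℂ) (tupleMaps N d x) hkl ⊥
      (fun a h => absurd h a.not_lt_zero) ?_
    rw [rkExt_eq_zero (by omega), rkExt_eq_zero (by omega)] at hm
    rw [Submodule.map_bot, finrank_bot, finrank_bot]
    omega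
  | succ k =>
    have hkl' : k ≤ l := by omega
    have h3 := rkExt_eq_finrank hdiag hx hkl' (by omega) (by omega)
    have h4 := rkExt_eq_finrank hdiag hx (hkl'.trans l.le_succ) (by omega) (by omega)
    push_cast at h4 hm
    rw [add_sub_cancel_right, h3, h4] at hm
    refine exists_segMap_generator (V := fun i => Fin (d i) → ℂ) (tupleMaps N d x) hkl
      (LinearMap.range (segMap (V := fun i => Fin (d i) → ℂ) (tupleMaps N d x) k hkl'))
      (fun a h => ?_) ?_
    · rw [segMap_comp _ (Nat.le_of_lt_succ h) hkl']
      exact LinearMap.range_comp_le_range _ _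
    · have h5 := congrArg (fun f => finrank ℂ (LinearMap.range f))
        (segMap_succ (V := fun i => Fin (d i) → ℂ) (tupleMaps N d x) hkl' (hkl'.trans l.le_succ))
      rw [← LinearMap.range_comp]
      linarith

/-- The rank pattern obtained from `s` by exchanging the endpoints of the intervals
`[i, j]` and `[k, l]`. -/
def exchangePattern (s : ℕ → ℕ → ℕ) (i j k l a b : ℕ) : ℕ :=
  s a b + if i ≤ a ∧ a < k ∧ j < b ∧ b ≤ l then 1 else 0

theorem mem_closure_rankLocus_exchangePattern {s : ℕ → ℕ → ℕ} (hdiag : ∀ i ≤ N, s i i = d i)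
    {x : ∀ i : Fin N, Matrix (Fin (d ((i : ℕ) + 1))) (Fin (d (i : ℕ))) ℂ}
    (hx : x ∈ rankLocus N d s) {i j k l : ℕ} (hik : i < k) (hkj : k ≤ j + 1) (hjl : j < l)
    (hl : l ≤ N) (hij : 0 < intervalMult (rkExt N s) i j)
    (hkl : 0 < intervalMult (rkExt N s) k l) :
    x ∈ closure (rankLocus N d (exchangePattern s i j k l)) := by
  have hij' : i ≤ j := by omega
  have hkl' : k ≤ l := by omega
  obtain ⟨w, φ, hw, hφw, hφ⟩ := exists_tuple_generator hdiag hx hij' (by omega) hij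
  obtain ⟨v, χ, hv, hχv, hχ⟩ := exists_tuple_generator hdiag hx hkl' hl hkl
  have hjN : j < N := by omega
  let u := segMap (V := fun i => Fin (d i) → ℂ) (tupleMaps N d x) k hkj v
  let B : ∀ i : Fin N, Matrix (Fin (d ((i : ℕ) + 1))) (Fin (d (i : ℕ))) ℂ :=
    Pi.single ⟨j, hjN⟩ (LinearMap.toMatrix' (φ.smulRight u))
  have htend : Filter.Tendsto (fun t : ℂ => x + t • B) (nhdsWithin 0 {0}ᶜ) (nhds x) := by
    have : Continuous fun t : ℂ => x + t • B := by fun_prop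
    simpa using (this.tendsto 0).mono_left nhdsWithin_le_nhds
  have hunit : ∀ᶠ t : ℂ in nhdsWithin 0 {0}ᶜ, ∀ h : k ≤ j,
      1 + t * φ (segMap (V := fun i => Fin (d i) → ℂ) (tupleMaps N d x) k h v) ≠ 0 := by
    refine Filter.eventually_all.2 fun h => Filter.Eventually.filter_mono nhdsWithin_le_nhds ?_
    refine ContinuousAt.eventually_ne (by fun_prop) ?_
    simp
  refine mem_closure_of_tendsto htend ?_
  filter_upwards [hunit, self_mem_nhdsWithin] with t ht' ht
  refine mem_rankLocus_iff.2 fun a b hab hb => ?_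
  rw [exchangePattern, ← mem_rankLocus_iff.1 hx a b hab hb]
  refine finrank_range_segMap_add_smulRight (V := fun i => Fin (d i) → ℂ) hij' hkl' hkj hv ?_
    hw hφw hφ ht ht' (fun n hn => ?_) ?_ hab.le
  · rintro a ha ⟨z, hz⟩
    apply hχv
    rw [← hz]
    exact LinearMap.congr_fun (hχ a ha) z
  · unfold tupleMaps
    by_cases h : n < N
    · have : (⟨n, h⟩ : Fin N) ≠ ⟨j, hjN⟩ := by simpa using hn
      simp [h, B, Pi.single_eq_of_ne this]
    · simp [h]
  · unfold tupleMaps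
    rw [dif_pos hjN, dif_pos hjN, Pi.add_apply, Pi.smul_apply, ← Matrix.toLin'_apply',
      ← Matrix.toLin'_apply', map_add, map_smul]
    simp only [B, Pi.single_eq_same]
    rw [Matrix.toLin'_toMatrix']
    rfl

theorem rkExt_exchangePattern {s : ℕ → ℕ → ℕ} {i j k l : ℕ} (hkj : k ≤ j + 1) (hl : l ≤ N)
    (a b : ℤ) :
    rkExt N (exchangePattern s i j k l) a b =
      rkExt N s a b + if (i : ℤ) ≤ a ∧ a < k ∧ (j : ℤ) < b ∧ b ≤ l then 1 else 0 := by
  unfold rkExt exchangePattern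
  by_cases h : 0 ≤ a ∧ a ≤ b ∧ b ≤ (N : ℤ)
  · rw [if_pos h, if_pos h]
    push_cast
    congr 2
    exact propext (by omega)
  · rw [if_neg h, if_neg h, if_neg (by omega), add_zero]

theorem RankAdmissible.exchangePattern {s : ℕ → ℕ → ℕ} (hs : RankAdmissible N s)
    {i j k l : ℕ} (hik : i < k) (hkj : k ≤ j + 1) (hjl : j < l) (hl : l ≤ N)
    (hij : 0 < intervalMult (rkExt N s) i j) (hkl : 0 < intervalMult (rkExt N s) k l) :
    RankAdmissible N (exchangePattern s i j k l) := by
  intro a b ha hab hb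
  simp only [rkExt_exchangePattern hkj hl]
  have h := hs a b ha hab hb
  have h1 : a = i ∧ b = j → 1 ≤ rkExt N s a b - rkExt N s a (b + 1) - rkExt N s (a - 1) b +
      rkExt N s (a - 1) (b + 1) := by
    rintro ⟨rfl, rfl⟩
    exact hij
  have h2 : a = k ∧ b = l → 1 ≤ rkExt N s a b - rkExt N s a (b + 1) - rkExt N s (a - 1) b +
      rkExt N s (a - 1) (b + 1) := by
    rintro ⟨rfl, rfl⟩
    exact hkl
  split_ifs <;> omega

theorem rankLocus_subset_closure {r : ℕ → ℕ → ℕ} (hrdiag : ∀ i ≤ N, r i i = d i)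
    (hradm : RankAdmissible N r) (s : ℕ → ℕ → ℕ) (hsdiag : ∀ i ≤ N, s i i = d i)
    (hsadm : RankAdmissible N s) (hle : ∀ i j : ℕ, i < j → j ≤ N → s i j ≤ r i j) :
    rankLocus N d s ⊆ closure (rankLocus N d r) := by
  induction hn : ∑ p ∈ Finset.range (N + 1) ×ˢ Finset.range (N + 1), (r p.1 p.2 - s p.1 p.2)
    using Nat.strong_induction_on generalizing s with
  | _ n ih =>
  by_cases heq : ∀ i j : ℕ, i < j → j ≤ N → s i j = r i j
  · exact fun x hx => subset_closure fun i j hij hj => (hx i j hij hj).trans (heq i j hij hj)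
  push Not at heq
  obtain ⟨a, b, hab, hb, hne⟩ := heq
  have hle' : ∀ i j : ℤ, 0 ≤ i → i ≤ j → j ≤ N → rkExt N s i j ≤ rkExt N r i j := by
    intro i j hi hij hj
    lift i to ℕ using hi
    lift j to ℕ using by omega
    rw [rkExt_of_le (by omega) (by omega), rkExt_of_le (by omega) (by omega)]
    rcases (Int.ofNat_le.1 hij).lt_or_eq with h | rfl
    · exact_mod_cast hle i j h (by omega)
    · rw [hrdiag i (by omega), hsdiag i (by omega)]
  obtain ⟨i, j, k, l, hi, hik, hkj, hjl, hl, hij, hkl, hlt⟩ :=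
    exists_exchange (N := N) (R := rkExt N r) (S := rkExt N s) hradm
      (fun _ _ => rkExt_eq_zero) (fun _ _ => rkExt_eq_zero) hle'
      (fun i hi hiN => by
        lift i to ℕ using hi
        rw [rkExt_of_le le_rfl (by omega), rkExt_of_le le_rfl (by omega), hrdiag i (by omega),
          hsdiag i (by omega)])
      (a₀ := a) (b₀ := b) (by omega) (by omega) (by omega) (by
        rw [rkExt_of_le hab.le hb, rkExt_of_le hab.le hb]
        have := hle a b hab hb
        omega)
  lift i to ℕ using hi
  lift k to ℕ using by omega
  lift j to ℕ using by omega
  lift l to ℕ using by omega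
  have hkj' : k ≤ j + 1 := by omega
  have hlN : l ≤ N := by omega
  have hlt' : ∀ a b : ℕ, i ≤ a → a < k → j < b → b ≤ l → s a b < r a b := by
    intro a b h1 h2 h3 h4
    have := hlt a b (by omega) (by omega) (by omega) (by omega)
    rwa [rkExt_of_le (by omega) (by omega), rkExt_of_le (by omega) (by omega), Nat.cast_lt] at this
  have hsub : rankLocus N d s ⊆ closure (rankLocus N d (exchangePattern s i j k l)) := fun x hx =>
    mem_closure_rankLocus_exchangePattern hsdiag hx (by omega) hkj' (by omega) hlN hij hkl
  refine hsub.trans (closure_minimal (ih _ ?_ _ (fun a ha => ?_)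
    (hsadm.exchangePattern (by omega) hkj' (by omega) hlN hij hkl) (fun a b h1 h2 => ?_) rfl)
    isClosed_closure)
  · rw [← hn]
    refine Finset.sum_lt_sum (fun p _ => Nat.sub_le_sub_left (Nat.le_add_right _ _) _)
      ⟨(i, l), by simp; omega, ?_⟩
    have := hlt' i l le_rfl (by omega) (by omega) le_rfl
    rw [exchangePattern, if_pos (by omega)]
    dsimp only
    omega
  · rw [exchangePattern, if_neg (by omega), add_zero, hsdiag a ha]
  · unfold exchangePattern
    split_ifs with h
    · exact hlt' a b h.1 h.2.1 h.2.2.1 h.2.2.2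
    · exact hle a b h1 h2

theorem rankLocus_nonempty {s : ℕ → ℕ → ℕ} (hsdiag : ∀ i ≤ N, s i i = d i)
    (hsadm : RankAdmissible N s) : (rankLocus N d s).Nonempty := by
  let z : ℕ → ℕ → ℕ := fun i j => if i = j then d i else 0
  have hz : (0 : ∀ i : Fin N, Matrix (Fin (d ((i : ℕ) + 1))) (Fin (d (i : ℕ))) ℂ) ∈
      rankLocus N d z := by
    refine mem_rankLocus_iff.2 fun i j hij hj => ?_
    obtain ⟨j, rfl⟩ : ∃ j', j = j' + 1 := ⟨j - 1, by omega⟩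
    have h0 : tupleMaps N d 0 j = 0 := by
      rw [tupleMaps]
      split_ifs <;> exact Matrix.mulVecLin_zero
    rw [segMap_succ _ (Nat.le_of_lt_succ hij), h0, LinearMap.zero_comp, LinearMap.range_zero,
      finrank_bot]
    exact (if_neg hij.ne).symm
  have hzadm : RankAdmissible N z := by
    intro i j hi hij hj
    have hoff : ∀ a b : ℤ, a < b → rkExt N z a b = 0 := by
      intro a b hab
      simp only [rkExt, z]
      split_ifs <;> omega
    rw [hoff i (j + 1) (by omega), hoff (i - 1) j (by omega), hoff (i - 1) (j + 1) (by omega)]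
    simp only [rkExt]
    split_ifs <;> omega
  have := rankLocus_subset_closure hsdiag hsadm z (fun i _ => if_pos rfl) hzadm
    (fun i j hij _ => by simp [z, hij.ne]) hz
  exact closure_nonempty_iff.1 ⟨_, this⟩

theorem isClosed_setOf_matrix_rank_le {m n : ℕ} (c : ℕ) :
    IsClosed {M : Matrix (Fin m) (Fin n) ℂ | M.rank ≤ c} := by
  let F : Matrix (Fin m) (Fin n) ℂ →ₗ[ℂ] (Fin n → ℂ) →L[ℂ] (Fin m → ℂ) :=
    LinearMap.toContinuousLinearMap.toLinearMap ∘ₗ Matrix.toLin'.toLinearMap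
  have hF : Continuous F := F.continuous_of_finiteDimensional
  have hrank (M : Matrix (Fin m) (Fin n) ℂ) :
      (F M : (Fin n → ℂ) →ₗ[ℂ] (Fin m → ℂ)).rank = M.rank :=
    (Module.finrank_eq_rank ℂ (LinearMap.range M.mulVecLin)).symm
  have := ((isOpen_setOfPred_nat_le_rank (𝕜 := ℂ) (E := Fin n → ℂ) (F := Fin m → ℂ)
    (c + 1)).preimage hF).isClosed_compl
  convert this using 1
  ext M
  simp only [Set.mem_ofPred_eq, Set.mem_compl_iff, Set.mem_preimage, hrank, Nat.cast_le]
  omega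

theorem continuous_matProdSeg (N : ℕ) (d : ℕ → ℕ) (i n : ℕ) :
    Continuous fun x : ∀ i : Fin N, Matrix (Fin (d ((i : ℕ) + 1))) (Fin (d (i : ℕ))) ℂ =>
      matProdSeg ℂ d (fun i => if h : i < N then x ⟨i, h⟩ else 0) i n := by
  induction n with
  | zero => exact continuous_const
  | succ n ih =>
    refine Continuous.matrix_mul ?_ ih
    by_cases h : i + n < N
    · simp only [h, dif_pos]
      exact continuous_apply (⟨i + n, h⟩ : Fin N)
    · simp only [h, dif_neg, not_false_eq_true]
      exact continuous_const

end RankLocus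

/-- Orbit hierarchy: for admissible rank patterns `r, s` for `d`, the locus of rank
pattern `s` is contained in the Euclidean closure of the locus of rank pattern `r`
iff `s_{ij} ≤ r_{ij}` for all `0 ≤ i < j ≤ N`. -/
theorem stmt15 (N : ℕ) (hN : 1 ≤ N) (d : ℕ → ℕ) (r s : ℕ → ℕ → ℕ)
    (hrdiag : ∀ i ≤ N, r i i = d i) (hsdiag : ∀ i ≤ N, s i i = d i)
    (hradm : RankAdmissible N r) (hsadm : RankAdmissible N s) :
    rankLocus N d s ⊆ closure (rankLocus N d r) ↔
      ∀ i j : ℕ, i < j → j ≤ N → s i j ≤ r i j := by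
  refine ⟨fun h i j hij hj => ?_, rankLocus_subset_closure hrdiag hradm s hsdiag hsadm⟩
  obtain ⟨x, hx⟩ := rankLocus_nonempty hsdiag hsadm
  rw [← hx i j hij hj]
  exact closure_minimal (fun y hy => (hy i j hij hj).le)
    ((isClosed_setOf_matrix_rank_le (r i j)).preimage (continuous_matProdSeg N d i (j - i))) (h hx)
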